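/- Let η, ξ : ℤ → ℕ be height configurations that are mirror images of each other, i.e. ξ(x) = 3 − η(x) for all x ∈ ℤ (in particular η(x) ≤ 3 for all x). Then after one parallel toppling step the two configurations are again mirror images of each other: T(ξ)(x) = 3 − T(η)(x) for all x ∈ ℤ. -/

import Mathlib

/-- The parallel toppling map of the classical sandpile model on `ℤ`:
every unstable site (height `≥ 2`) loses two particles, one to each neighbor. -/
def parT (η : ℤ → ℕ) : ℤ → ℕ := fun x =>
  (η x - if 2 ≤ η x then 2 else 0)
    + (if 2 ≤ η (x - 1) then 1 else 0)
    + (if 2 ≤ η (x + 1) then 1 else 0)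

/-- Lemma 5.2 / mirror lemma: if `ξ` is the mirror image of `η`,
i.e. `ξ x = 3 - η x` for all `x` (in particular `η x ≤ 3`), then after one parallel
toppling step the two configurations are again mirror images of each other. -/
theorem mirror_lemma (η ξ : ℤ → ℕ) (hbound : ∀ x, η x ≤ 3)
    (hmirror : ∀ x, ξ x = 3 - η x) :
    ∀ x, parT ξ x = 3 - parT η x := by
  intro x
  have hl := hbound (x - 1)
  have hc := hbound x
  have hr := hbound (x + 1)
  simp only [parT, hmirror]
  split_ifs <;> omega
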